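/- Let x be a harmonic bounded operator on F. For every word J : List Θ the sequence (P_ω^n(x (r_J)*)) converges in SOT to a bounded operator y, and ⟪y Ω, Ω⟫ = ω_J · ⟪x Ω, r_J Ω⟫. More generally, for all words I, J the sequence (P_ω^n(x r_I (r_J)*)) converges in SOT to a bounded operator z with ⟪z Ω, Ω⟫ = ω_J · ⟪x r_I Ω, r_J Ω⟫. -/

import Mathlib

open Filter Topology

noncomputable section

/-- The full Fock space over a Hilbert space with orthonormal basis indexed by `Θ`,
realized as `ℓ²(List Θ)`. -/
abbrev Fock (Θ : Type*) : Type _ := lp (fun _ : List Θ => ℂ) 2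

/-- The canonical orthonormal basis vector `e_I` of the Fock space, indexed by a word
`I : List Θ`.  The vacuum vector is `Ω = fockBasis []`. -/
noncomputable def fockBasis {Θ : Type*} [DecidableEq Θ] (I : List Θ) : Fock Θ :=
  lp.single 2 I 1

/-- For a word `I = [i₁, …, i_k]`, `wordOp r I = r i₁ ∘L ⋯ ∘L r i_k`, the identity for the
empty word.  Applied to the right (resp. left) creation operators, this gives `r_I`
(resp. `l_I`). -/
noncomputable def wordOp {Θ : Type*} (r : Θ → Fock Θ →L[ℂ] Fock Θ) :
    List Θ → (Fock Θ →L[ℂ] Fock Θ)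
  | [] => 1
  | i :: I => r i ∘L wordOp r I

theorem fb_inner {Θ : Type*} [DecidableEq Θ] (I : List Θ) (v : Fock Θ) :
    inner ℂ (fockBasis I) v = v I := by
  simp [fockBasis, lp.inner_single_left]

theorem fb_apply {Θ : Type*} [DecidableEq Θ] (I J : List Θ) :
    (fockBasis I : Fock Θ) J = if J = I then 1 else 0 := by
  unfold fockBasis
  rw [lp.single_apply, Pi.single_apply]

theorem fb_norm {Θ : Type*} [DecidableEq Θ] (I : List Θ) : ‖(fockBasis I : Fock Θ)‖ = 1 := by
  have h := inner_self_eq_norm_sq (𝕜 := ℂ) (fockBasis I : Fock Θ)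
  rw [fb_inner, fb_apply, if_pos rfl] at h
  have h2 : (1 : ℝ) = ‖(fockBasis I : Fock Θ)‖ ^ 2 := by simpa using h
  exact (pow_eq_one_iff_of_nonneg (norm_nonneg _) two_ne_zero).1 h2.symm

theorem fb_vec_ext {Θ : Type*} [DecidableEq Θ] {u v : Fock Θ}
    (h : ∀ I, inner ℂ (fockBasis I) u = inner ℂ (fockBasis I) v) : u = v := by
  apply lp.ext
  funext I
  rw [← fb_inner, ← fb_inner, h]

theorem fb_op_ext {Θ : Type*} [DecidableEq Θ] {A B : Fock Θ →L[ℂ] Fock Θ}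
    (h : ∀ I, A (fockBasis I) = B (fockBasis I)) : A = B := by
  have key : ContinuousLinearMap.adjoint A = ContinuousLinearMap.adjoint B := by
    ext1 v
    apply fb_vec_ext
    intro I
    rw [ContinuousLinearMap.adjoint_inner_right, ContinuousLinearMap.adjoint_inner_right, h]
  exact ContinuousLinearMap.adjoint.injective key

/-- The rank one operator `v ↦ ⟪e_w, v⟫ ξ`. -/
def rkOne {Θ : Type*} [DecidableEq Θ] (ξ : Fock Θ) (w : List Θ) : Fock Θ →L[ℂ] Fock Θ :=
  (innerSL ℂ (fockBasis w)).smulRight ξ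

theorem rkOne_apply {Θ : Type*} [DecidableEq Θ] (ξ : Fock Θ) (w : List Θ) (v : Fock Θ) :
    rkOne ξ w v = (inner ℂ (fockBasis w) v : ℂ) • ξ := by
  simp [rkOne]

theorem fb_wordOp {Θ : Type*} [DecidableEq Θ] (r : Θ → Fock Θ →L[ℂ] Fock Θ)
    (hr : ∀ (i : Θ) (I : List Θ), r i (fockBasis I) = fockBasis (I ++ [i])) (J L : List Θ) :
    wordOp r J (fockBasis L) = fockBasis (L ++ J.reverse) := by
  induction J with
  | nil => simp [wordOp]
  | cons j J ih => simp [wordOp, ih, hr]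

theorem l_wordOp {Θ : Type*} [DecidableEq Θ] (l r : Θ → Fock Θ →L[ℂ] Fock Θ)
    (hl : ∀ (i : Θ) (I : List Θ), l i (fockBasis I) = fockBasis (i :: I))
    (hr : ∀ (i : Θ) (I : List Θ), r i (fockBasis I) = fockBasis (I ++ [i]))
    (i : Θ) (I : List Θ) (v : Fock Θ) :
    wordOp r I (l i v) = l i (wordOp r I v) := by
  have : wordOp r I ∘L l i = l i ∘L wordOp r I := by
    apply fb_op_ext
    intro K
    simp [fb_wordOp r hr, hl]
  exact DFunLike.congr_fun this v

theorem l_adj_nil {Θ : Type*} [DecidableEq Θ] (l : Θ → Fock Θ →L[ℂ] Fock Θ)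
    (hl : ∀ (i : Θ) (I : List Θ), l i (fockBasis I) = fockBasis (i :: I)) (i : Θ) :
    ContinuousLinearMap.adjoint (l i) (fockBasis []) = 0 := by
  apply fb_vec_ext
  intro I
  rw [ContinuousLinearMap.adjoint_inner_right, hl, fb_inner, fb_apply]
  simp

theorem l_adj_cons {Θ : Type*} [DecidableEq Θ] (l : Θ → Fock Θ →L[ℂ] Fock Θ)
    (hl : ∀ (i : Θ) (I : List Θ), l i (fockBasis I) = fockBasis (i :: I)) (i j : Θ)
    (w : List Θ) :
    ContinuousLinearMap.adjoint (l i) (fockBasis (j :: w))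
      = if i = j then fockBasis w else 0 := by
  apply fb_vec_ext
  intro I
  rw [ContinuousLinearMap.adjoint_inner_right, hl, fb_inner, fb_apply]
  by_cases h : i = j
  · simp [h, fb_inner, fb_apply]
  · simp [h]

theorem l_isom {Θ : Type*} [DecidableEq Θ] (l : Θ → Fock Θ →L[ℂ] Fock Θ)
    (hl : ∀ (i : Θ) (I : List Θ), l i (fockBasis I) = fockBasis (i :: I)) (i : Θ)
    (v : Fock Θ) : ‖l i v‖ = ‖v‖ := by
  have h : ContinuousLinearMap.adjoint (l i) ∘L l i = 1 := by
    apply fb_op_ext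
    intro K
    simp [hl, l_adj_cons l hl]
  have h2 : ‖l i v‖ ^ 2 = ‖v‖ ^ 2 := by
    have h3 := ContinuousLinearMap.apply_norm_sq_eq_inner_adjoint_right (l i) v
    rw [h3]
    have h4 := DFunLike.congr_fun h v
    simp only [ContinuousLinearMap.comp_apply, one_apply_eq_self] at h4
    rw [ContinuousLinearMap.comp_apply, h4, inner_self_eq_norm_sq]
  exact (sq_eq_sq₀ (norm_nonneg _) (norm_nonneg _)).1 h2

theorem l_adj_norm {Θ : Type*} [DecidableEq Θ] (l : Θ → Fock Θ →L[ℂ] Fock Θ)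
    (hl : ∀ (i : Θ) (I : List Θ), l i (fockBasis I) = fockBasis (i :: I)) (i : Θ) :
    ‖ContinuousLinearMap.adjoint (l i)‖ ≤ 1 := by
  rw [LinearIsometryEquiv.norm_map]
  apply ContinuousLinearMap.opNorm_le_bound _ zero_le_one
  intro v
  rw [l_isom l hl, one_mul]

theorem markov_summable {Θ : Type*} [DecidableEq Θ] (l : Θ → Fock Θ →L[ℂ] Fock Θ)
    (hl : ∀ (i : Θ) (I : List Θ), l i (fockBasis I) = fockBasis (i :: I))
    (ω : Θ → ℝ) (hω : ∀ i, 0 < ω i) (hω1 : ∑' i, ω i = 1)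
    (x : Fock Θ →L[ℂ] Fock Θ) (v : Fock Θ) :
    Summable fun i => (ω i : ℂ) • ((ContinuousLinearMap.adjoint (l i) ∘L x ∘L l i) v) := by
  have hs : Summable ω := by
    by_contra h
    rw [tsum_eq_zero_of_not_summable h] at hω1
    exact zero_ne_one hω1
  refine Summable.of_norm_bounded (hs.mul_right (‖x‖ * ‖v‖)) ?_
  intro i
  rw [norm_smul, Complex.norm_real, Real.norm_of_nonneg (hω i).le]
  refine mul_le_mul_of_nonneg_left ?_ (hω i).le
  simp only [ContinuousLinearMap.comp_apply]
  calc _ ≤ ‖ContinuousLinearMap.adjoint (l i)‖ * ‖x (l i v)‖ :=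
        ContinuousLinearMap.le_opNorm _ _
    _ ≤ 1 * ‖x (l i v)‖ := by gcongr; exact l_adj_norm l hl i
    _ ≤ ‖x‖ * ‖l i v‖ := by rw [one_mul]; exact ContinuousLinearMap.le_opNorm _ _
    _ = _ := by rw [l_isom l hl]

theorem wordOp_adj_l {Θ : Type*} [DecidableEq Θ] (l r : Θ → Fock Θ →L[ℂ] Fock Θ)
    (hl : ∀ (i : Θ) (I : List Θ), l i (fockBasis I) = fockBasis (i :: I))
    (hr : ∀ (i : Θ) (I : List Θ), r i (fockBasis I) = fockBasis (I ++ [i]))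
    (i : Θ) (J : List Θ) (v : Fock Θ) :
    ContinuousLinearMap.adjoint (wordOp r J) (l i v)
      = l i (ContinuousLinearMap.adjoint (wordOp r J) v)
        + rkOne (fockBasis []) J.reverse (l i v) := by
  have : ContinuousLinearMap.adjoint (wordOp r J) ∘L l i
      = l i ∘L ContinuousLinearMap.adjoint (wordOp r J)
        + rkOne (fockBasis []) J.reverse ∘L l i := by
    apply fb_op_ext
    intro K
    apply fb_vec_ext
    intro L
    simp only [add_apply, ContinuousLinearMap.comp_apply, hl, rkOne_apply,
      inner_add_right, inner_smul_right]
    rw [ContinuousLinearMap.adjoint_inner_right, fb_wordOp r hr,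
      ← ContinuousLinearMap.adjoint_inner_left]
    cases L with
    | nil =>
      rw [l_adj_nil l hl]
      simp [fb_inner, fb_apply, fb_norm]
    | cons j M =>
      rw [l_adj_cons l hl]
      by_cases h : i = j
      · rw [if_pos h, ContinuousLinearMap.adjoint_inner_right, fb_wordOp r hr]
        simp [fb_inner, fb_apply, h]
      · have h' : ¬ j = i := fun e => h e.symm
        simp [fb_inner, fb_apply, h, h']
  exact DFunLike.congr_fun this v

theorem markov_main {Θ : Type*} [DecidableEq Θ]
    (l r : Θ → Fock Θ →L[ℂ] Fock Θ)
    (hl : ∀ (i : Θ) (I : List Θ), l i (fockBasis I) = fockBasis (i :: I))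
    (hr : ∀ (i : Θ) (I : List Θ), r i (fockBasis I) = fockBasis (I ++ [i]))
    (ω : Θ → ℝ) (hω : ∀ i, 0 < ω i) (hω1 : ∑' i, ω i = 1)
    (P : (Fock Θ →L[ℂ] Fock Θ) → (Fock Θ →L[ℂ] Fock Θ))
    (hP : ∀ (x : Fock Θ →L[ℂ] Fock Θ) (v : Fock Θ),
      P x v = ∑' i, (ω i : ℂ) • ((ContinuousLinearMap.adjoint (l i) ∘L x ∘L l i) v))
    (x : Fock Θ →L[ℂ] Fock Θ) (hx : P x = x) (I J : List Θ) :
    ∃ z : Fock Θ →L[ℂ] Fock Θ,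
      (∀ v : Fock Θ,
        Tendsto
          (fun n : ℕ =>
            (P^[n] (x ∘L wordOp r I ∘L ContinuousLinearMap.adjoint (wordOp r J))) v)
          atTop (𝓝 (z v))) ∧
      (inner ℂ (z (fockBasis ([] : List Θ))) (fockBasis ([] : List Θ)) : ℂ)
        = (((J.map ω).prod : ℝ) : ℂ)
            * (inner ℂ (x (wordOp r I (fockBasis ([] : List Θ))))
                (wordOp r J (fockBasis ([] : List Θ))) : ℂ) := by
  have hsum := markov_summable l hl ω hω hω1
  have hadd : ∀ A B, P (A + B) = P A + P B := by
    intro A B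
    ext1 v
    rw [add_apply, hP, hP, hP, ← (hsum A v).tsum_add (hsum B v)]
    simp
  have hsmul : ∀ (c : ℂ) A, P (c • A) = c • P A := by
    intro c A
    ext1 v
    rw [smul_apply, hP, hP, ← (hsum A v).tsum_const_smul]
    congr 1
    funext i
    simp only [ContinuousLinearMap.comp_apply, smul_apply, map_smul]
    rw [smul_comm]
  have h0 : P 0 = 0 := by simpa using hsmul 0 0
  have hRnil : ∀ ξ, P (rkOne ξ []) = 0 := by
    intro ξ
    ext1 v
    rw [hP]
    simp [rkOne_apply, ← ContinuousLinearMap.adjoint_inner_left, l_adj_nil l hl]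
  have hRcons : ∀ ξ j w, P (rkOne ξ (j :: w))
      = (ω j : ℂ) • rkOne (ContinuousLinearMap.adjoint (l j) ξ) w := by
    intro ξ j w
    ext1 v
    rw [hP, tsum_eq_single j]
    · rw [smul_apply]
      congr 1
      simp [rkOne_apply, ← ContinuousLinearMap.adjoint_inner_left, l_adj_cons l hl]
    · intro i hi
      simp [rkOne_apply, ← ContinuousLinearMap.adjoint_inner_left, l_adj_cons l hl, hi]
  -- the Green operator of a rank one operator
  have hG : ∀ (w : List Θ) (ξ : Fock Θ), ∃ G : Fock Θ →L[ℂ] Fock Θ,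
      G = rkOne ξ w + P G ∧ P^[w.length + 1] G = 0 ∧
      inner ℂ (G (fockBasis [])) (fockBasis [])
        = (((w.map ω).prod : ℝ) : ℂ) * inner ℂ ξ (fockBasis w) := by
    intro w
    induction w with
    | nil =>
      intro ξ
      refine ⟨rkOne ξ [], ?_, ?_, ?_⟩
      · rw [hRnil, add_zero]
      · simpa using hRnil ξ
      · simp [rkOne_apply, fb_norm]
    | cons j w ih =>
      intro ξ
      obtain ⟨G, h1, h2, h3⟩ := ih (ContinuousLinearMap.adjoint (l j) ξ)
      have hPG : P (rkOne ξ (j :: w) + (ω j : ℂ) • G) = (ω j : ℂ) • G := by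
        rw [hadd, hRcons, hsmul, ← smul_add, ← h1]
      have hit : ∀ n, P^[n] ((ω j : ℂ) • G) = (ω j : ℂ) • P^[n] G := by
        intro n
        induction n with
        | zero => rfl
        | succ n ihn => rw [Function.iterate_succ_apply', ihn, hsmul,
            Function.iterate_succ_apply']
      refine ⟨rkOne ξ (j :: w) + (ω j : ℂ) • G, ?_, ?_, ?_⟩
      · rw [hPG]
      · rw [List.length_cons, Function.iterate_succ_apply, hPG, hit, h2, smul_zero]
      · rw [add_apply, inner_add_left, smul_apply,
          inner_smul_left, h3, ContinuousLinearMap.adjoint_inner_left, hl]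
        simp [rkOne_apply, fb_inner, fb_apply, mul_assoc]
  set ξ := x (wordOp r I (fockBasis [])) with hξ
  set T := x ∘L wordOp r I ∘L ContinuousLinearMap.adjoint (wordOp r J) with hT
  have hPT : P T = T + P (rkOne ξ J.reverse) := by
    ext1 v
    have e1 : T v = P x (wordOp r I (ContinuousLinearMap.adjoint (wordOp r J) v)) := by
      rw [hx]; rfl
    rw [add_apply, e1, hP T, hP x, hP (rkOne ξ J.reverse),
      ← (hsum _ _).tsum_add (hsum _ _)]
    congr 1
    funext i
    rw [← smul_add]
    congr 1
    simp only [hT, ContinuousLinearMap.comp_apply]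
    rw [wordOp_adj_l l r hl hr, map_add, map_add, map_add, l_wordOp l r hl hr]
    simp [rkOne_apply, hξ]
  obtain ⟨G, h1, h2, h3⟩ := hG J.reverse ξ
  set z := T + P G with hz
  have hPz : P z = z := by
    conv_rhs => rw [hz, h1]
    rw [hz, hadd, hPT, hadd, add_assoc]
  have hzero : ∀ n, P^[n] 0 = 0 := fun n => Function.iterate_fixed h0 n
  have hadditer : ∀ n A B, P^[n] (A + B) = P^[n] A + P^[n] B := by
    intro n
    induction n with
    | zero => intro A B; rfl
    | succ n ih => intro A B; simp only [Function.iterate_succ_apply, hadd, ih]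
  have hn : ∀ n, J.reverse.length ≤ n → P^[n] T = z := by
    intro n hn
    have a1 : P^[n] z = z := Function.iterate_fixed hPz n
    have a2 : P^[n] (P G) = 0 := by
      obtain ⟨k, rfl⟩ := Nat.exists_eq_add_of_le' hn
      rw [Function.iterate_add_apply, ← Function.iterate_succ_apply, h2, hzero]
    have a3 := hadditer n T (P G)
    rw [← hz, a1, a2, add_zero] at a3
    exact a3.symm
  refine ⟨z, ?_, ?_⟩
  · intro v
    apply tendsto_const_nhds.congr'
    filter_upwards [eventually_ge_atTop J.reverse.length] with n hn'
    rw [hn n hn']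
  · have hadj : ContinuousLinearMap.adjoint (wordOp r J) (fockBasis [])
        = rkOne (fockBasis []) J.reverse (fockBasis []) := by
      apply fb_vec_ext
      intro L
      rw [ContinuousLinearMap.adjoint_inner_right, fb_wordOp r hr, rkOne_apply,
        inner_smul_right]
      simp only [fb_inner, fb_apply]
      cases L <;> simp
    have hzv : z (fockBasis []) = G (fockBasis []) := by
      conv_rhs => rw [h1]
      rw [hz, add_apply, add_apply]
      congr 1
      simp only [hT, ContinuousLinearMap.comp_apply, hadj]
      simp [rkOne_apply, hξ]
    rw [hzv, h3, fb_wordOp r hr]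
    simp [List.map_reverse, List.prod_reverse]

/-- For harmonic `x` and every word `J`, the sequence `(P_ω^n (x (r_J)*))`
converges in SOT to some bounded operator `y` with `⟪y Ω, Ω⟫ = ω_J • ⟪x Ω, r_J Ω⟫`; more
generally for all words `I, J` the sequence `(P_ω^n (x r_I (r_J)*))` converges in SOT to some
`z` with `⟪z Ω, Ω⟫ = ω_J • ⟪x r_I Ω, r_J Ω⟫`. -/
theorem statement9 {Θ : Type*} [Countable Θ] [Nonempty Θ] [DecidableEq Θ]
    (l r : Θ → Fock Θ →L[ℂ] Fock Θ)
    (hl : ∀ (i : Θ) (I : List Θ), l i (fockBasis I) = fockBasis (i :: I))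
    (hr : ∀ (i : Θ) (I : List Θ), r i (fockBasis I) = fockBasis (I ++ [i]))
    (ω : Θ → ℝ) (hω : ∀ i, 0 < ω i) (hω1 : ∑' i, ω i = 1)
    (P : (Fock Θ →L[ℂ] Fock Θ) → (Fock Θ →L[ℂ] Fock Θ))
    (hP : ∀ (x : Fock Θ →L[ℂ] Fock Θ) (v : Fock Θ),
      P x v = ∑' i, (ω i : ℂ) • ((ContinuousLinearMap.adjoint (l i) ∘L x ∘L l i) v))
    (x : Fock Θ →L[ℂ] Fock Θ) (hx : P x = x) :
    (∀ J : List Θ, ∃ y : Fock Θ →L[ℂ] Fock Θ,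
      (∀ v : Fock Θ,
        Tendsto (fun n : ℕ => (P^[n] (x ∘L ContinuousLinearMap.adjoint (wordOp r J))) v)
          atTop (𝓝 (y v))) ∧
      (inner ℂ (y (fockBasis ([] : List Θ))) (fockBasis ([] : List Θ)) : ℂ)
        = (((J.map ω).prod : ℝ) : ℂ)
            * (inner ℂ (x (fockBasis ([] : List Θ))) (wordOp r J (fockBasis ([] : List Θ))) : ℂ)) ∧
    (∀ I J : List Θ, ∃ z : Fock Θ →L[ℂ] Fock Θ,
      (∀ v : Fock Θ,
        Tendsto
          (fun n : ℕ =>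
            (P^[n] (x ∘L wordOp r I ∘L ContinuousLinearMap.adjoint (wordOp r J))) v)
          atTop (𝓝 (z v))) ∧
      (inner ℂ (z (fockBasis ([] : List Θ))) (fockBasis ([] : List Θ)) : ℂ)
        = (((J.map ω).prod : ℝ) : ℂ)
            * (inner ℂ (x (wordOp r I (fockBasis ([] : List Θ))))
                (wordOp r J (fockBasis ([] : List Θ))) : ℂ)) := by
  have main := markov_main l r hl hr ω hω hω1 P hP x hx
  refine ⟨fun J => ?_, main⟩
  exact main [] J
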